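/- arXiv:2605.10300 — 2 statements merged into one kernel-verified Lean document; each statement's English description precedes it below -/
import Mathlib

section
/- For every nonnegative integer N, the even-index part of the q-series (q^4;q^4)_∞ · S(q) equals the Hecke-type double sum: ((q^4;q^4)_∞ S(q)) | S_{2,0} = Σ_{n≥0} (-1)^n q^{6n²+4n} (1+q^{4n+2}) Σ_{|j|≤n} (-1)^j q^{-2j²}, as an identity of formal power series (equivalently of holomorphic functions on |q|<1). -/
open scoped BigOperators

/-- Infinite q-Pochhammer symbol `(a; q)_∞ = ∏_{j ≥ 0} (1 - a q^j)`. -/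
noncomputable def pochInf (a q : ℂ) : ℂ := ∏' j : ℕ, (1 - a * q ^ j)

/-- Finite q-Pochhammer symbol `(a; q)_n = ∏_{j = 0}^{n-1} (1 - a q^j)`. -/
noncomputable def pochN (a q : ℂ) (n : ℕ) : ℂ := ∏ j ∈ Finset.range n, (1 - a * q ^ j)

/-- `S(q) = Σ_{n ≥ 0} (q; q²)_n² q^{2n} / (−q²; q²)_n`. -/
noncomputable def Sq (q : ℂ) : ℂ :=
  ∑' n : ℕ, pochN q (q ^ 2) n ^ 2 * q ^ (2 * n) / pochN (-q ^ 2) (q ^ 2) n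

open Filter Topology

/-- The reciprocal `1 / (x; x)_m`, extended by `0` to negative integers `m`. -/
noncomputable def pochRecip (x : ℂ) (m : ℤ) : ℂ :=
  if m < 0 then 0 else (pochN x x m.toNat)⁻¹

lemma pochN_succ (a q : ℂ) (n : ℕ) : pochN a q (n + 1) = pochN a q n * (1 - a * q ^ n) :=
  Finset.prod_range_succ _ _

lemma pochN_zero (a q : ℂ) : pochN a q 0 = 1 := Finset.prod_range_zero _

lemma one_sub_mul_pow_ne_zero {a x : ℂ} (ha : ‖a‖ < 1) (hx : ‖x‖ < 1) (i : ℕ) :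
    1 - a * x ^ i ≠ 0 := by
  intro h
  have h1 : ‖a * x ^ i‖ = 1 := by rw [← sub_eq_zero.mp h, norm_one]
  have h2 : ‖x‖ ^ i ≤ 1 := pow_le_one₀ (norm_nonneg _) hx.le
  rw [norm_mul, norm_pow] at h1
  nlinarith [norm_nonneg a]

lemma pochN_ne_zero {a x : ℂ} (ha : ‖a‖ < 1) (hx : ‖x‖ < 1) (n : ℕ) : pochN a x n ≠ 0 :=
  Finset.prod_ne_zero_iff.mpr fun i _ => one_sub_mul_pow_ne_zero ha hx i

lemma summable_norm_neg_mul_pow {x : ℂ} (a : ℂ) (hx : ‖x‖ < 1) :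
    Summable fun i : ℕ => ‖-(a * x ^ i)‖ := by
  simp only [norm_neg, norm_mul, norm_pow]
  exact (summable_geometric_of_lt_one (norm_nonneg _) hx).mul_left _

lemma tendsto_pochN {x : ℂ} (a : ℂ) (hx : ‖x‖ < 1) :
    Tendsto (pochN a x) atTop (𝓝 (pochInf a x)) := by
  have h := (multipliable_one_add_of_summable (summable_norm_neg_mul_pow a hx)).hasProd
  simp only [← sub_eq_add_neg] at h
  exact h.tendsto_prod_nat

lemma pochInf_ne_zero {a x : ℂ} (ha : ‖a‖ < 1) (hx : ‖x‖ < 1) : pochInf a x ≠ 0 := by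
  have h := tprod_one_add_ne_zero_of_summable (f := fun i : ℕ => -(a * x ^ i))
    (fun i => by simpa only [← sub_eq_add_neg] using one_sub_mul_pow_ne_zero ha hx i)
    (summable_norm_neg_mul_pow a hx)
  simp only [← sub_eq_add_neg] at h
  exact h

lemma exists_norm_le_of_tendsto {f : ℕ → ℂ} {l : ℂ} (h : Tendsto f atTop (𝓝 l)) :
    ∃ C, 0 ≤ C ∧ ∀ n, ‖f n‖ ≤ C := by
  obtain ⟨C, hC⟩ := h.norm.bddAbove_range
  exact ⟨C, (norm_nonneg _).trans (hC ⟨0, rfl⟩), fun n => hC ⟨n, rfl⟩⟩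

lemma norm_sq_lt_one {x : ℂ} (hx : ‖x‖ < 1) : ‖x ^ 2‖ < 1 := by
  rw [norm_pow]; exact pow_lt_one₀ (norm_nonneg _) hx two_ne_zero

lemma pochRecip_natCast (x : ℂ) (m : ℕ) : pochRecip x m = (pochN x x m)⁻¹ := by
  simp [pochRecip]

lemma pochRecip_of_neg (x : ℂ) {m : ℤ} (hm : m < 0) : pochRecip x m = 0 := by
  simp [pochRecip, hm]

lemma pochRecip_sub_one {x : ℂ} (hx : ‖x‖ < 1) (m : ℤ) :
    pochRecip x (m - 1) = (1 - x ^ m) * pochRecip x m := by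
  rcases lt_trichotomy m 0 with h | h | h
  · rw [pochRecip_of_neg x h, pochRecip_of_neg x (by omega), mul_zero]
  · subst h; rw [pochRecip_of_neg x (by omega)]; simp
  · obtain ⟨k, rfl⟩ : ∃ k : ℕ, m = (k + 1 : ℕ) := ⟨(m - 1).toNat, by omega⟩
    have h1 : ((k + 1 : ℕ) : ℤ) - 1 = k := by push_cast; ring
    rw [h1, pochRecip_natCast, pochRecip_natCast, zpow_natCast, pochN_succ, ← pow_succ']
    have h2 : 1 - x ^ (k + 1) ≠ 0 := by
      rw [pow_succ']; exact one_sub_mul_pow_ne_zero hx hx k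
    have h3 := pochN_ne_zero hx hx k
    field_simp

lemma exists_norm_pochRecip_le {x : ℂ} (hx : ‖x‖ < 1) :
    ∃ C, 0 ≤ C ∧ ∀ m, ‖pochRecip x m‖ ≤ C := by
  obtain ⟨C, hC0, hC⟩ :=
    exists_norm_le_of_tendsto ((tendsto_pochN x hx).inv₀ (pochInf_ne_zero hx hx))
  refine ⟨C, hC0, fun m => ?_⟩
  by_cases hm : m < 0
  · simpa [pochRecip_of_neg x hm] using hC0
  · simpa [pochRecip, hm] using hC m.toNat

lemma tendsto_pochRecip {x : ℂ} (hx : ‖x‖ < 1) (a : ℤ) :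
    Tendsto (fun n : ℕ => pochRecip x (n + a)) atTop (𝓝 (pochInf x x)⁻¹) := by
  have h := (tendsto_pochN x hx).inv₀ (pochInf_ne_zero hx hx)
  have h2 : Tendsto (fun n : ℕ => ((n : ℤ) + a).toNat) atTop atTop := by
    refine tendsto_atTop.mpr fun b => ?_
    filter_upwards [eventually_ge_atTop (b + a.natAbs)] with n hn
    omega
  refine (h.comp h2).congr' ?_
  filter_upwards [eventually_ge_atTop a.natAbs] with n hn
  have : ¬ ((n : ℤ) + a < 0) := by omega
  simp [pochRecip, this]

/-- `(x; x)_{2n} = (-x; x)_n (x; x²)_n (x; x)_n`. -/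
lemma pochN_two_mul (x : ℂ) (n : ℕ) :
    pochN x x (2 * n) = pochN (-x) x n * (pochN x (x ^ 2) n * pochN x x n) := by
  induction n with
  | zero => simp [pochN_zero]
  | succ n ih =>
    rw [show 2 * (n + 1) = 2 * n + 1 + 1 by ring, pochN_succ, pochN_succ, ih, pochN_succ,
      pochN_succ, pochN_succ]
    ring

/-- `(x; x)_n (-x; x)_n = (x²; x²)_n`. -/
lemma pochN_mul_pochN_neg (x : ℂ) (n : ℕ) :
    pochN x x n * pochN (-x) x n = pochN (x ^ 2) (x ^ 2) n := by
  rw [pochN, pochN, pochN, ← Finset.prod_mul_distrib]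
  exact Finset.prod_congr rfl fun i _ => by ring

/-- The finite Jacobi triple product at `z = 1`. -/
lemma hasSum_finite_jacobi {q x : ℂ} (hq : q ≠ 0) (hx : ‖x‖ < 1) (hqx : x = q ^ 2) (n : ℕ) :
    HasSum (fun j : ℤ => (-1 : ℂ) ^ j * q ^ (j ^ 2) *
      (pochN x x (2 * n) * pochRecip x (n - j) * pochRecip x (n + j))) (pochN q x n ^ 2) := by
  have hx0 : x ≠ 0 := by rw [hqx]; exact pow_ne_zero 2 hq
  induction n with
  | zero =>
    have h := hasSum_single (f := fun j : ℤ => (-1 : ℂ) ^ j * q ^ (j ^ 2) *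
      (pochN x x (2 * 0) * pochRecip x ((0 : ℕ) - j) * pochRecip x ((0 : ℕ) + j))) 0
      (fun j hj => by
        rcases lt_or_gt_of_ne hj with h | h
        · rw [pochRecip_of_neg x (m := ((0 : ℕ) : ℤ) + j) (by simpa using h)]; simp
        · rw [pochRecip_of_neg x (m := ((0 : ℕ) : ℤ) - j) (by simpa using h)]; simp)
    have h0 : pochRecip x 0 = 1 := by simpa [pochN_zero] using pochRecip_natCast x 0
    simpa [pochN_zero, h0] using h
  | succ n ih =>
    have hl := (Equiv.subRight (1 : ℤ)).hasSum_iff.mpr ih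
    have hr := (Equiv.addRight (1 : ℤ)).hasSum_iff.mpr ih
    have h := (ih.mul_left (1 + x ^ (2 * n + 1))).sub ((hl.add hr).mul_left (q ^ (2 * n + 1)))
    have hval : (1 + x ^ (2 * n + 1)) * pochN q x n ^ 2 -
        q ^ (2 * n + 1) * (pochN q x n ^ 2 + pochN q x n ^ 2) = pochN q x (n + 1) ^ 2 := by
      rw [pochN_succ, hqx]; ring
    rw [hval] at h
    refine h.congr_fun fun j => ?_
    have e1 : pochRecip x (n - j) = (1 - x ^ ((n : ℤ) + 1 - j)) * pochRecip x (n + 1 - j) := by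
      rw [← pochRecip_sub_one hx]; congr 1; ring
    have e2 : pochRecip x (n + j) = (1 - x ^ ((n : ℤ) + 1 + j)) * pochRecip x (n + 1 + j) := by
      rw [← pochRecip_sub_one hx]; congr 1; ring
    have e3 : pochRecip x (n + (j - 1)) = (1 - x ^ ((n : ℤ) + j)) * pochRecip x (n + j) := by
      rw [← pochRecip_sub_one hx]; congr 1; ring
    have e4 : pochRecip x (n - (j + 1)) = (1 - x ^ ((n : ℤ) - j)) * pochRecip x (n - j) := by
      rw [← pochRecip_sub_one hx]; congr 1; ring
    have e5 : (n : ℤ) - (j - 1) = n + 1 - j := by ring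
    have e6 : (n : ℤ) + (j + 1) = n + 1 + j := by ring
    have q1 : q ^ ((j - 1) ^ 2) = q ^ (j ^ 2) * q * (q ^ j)⁻¹ ^ 2 := by
      rw [show (j - 1) ^ 2 = j ^ 2 + 1 + (-j) * (2 : ℕ) by push_cast; ring, zpow_add₀ hq,
        zpow_add₀ hq, zpow_mul, zpow_natCast, zpow_neg, zpow_one]
    have q2 : q ^ ((j + 1) ^ 2) = q ^ (j ^ 2) * q * (q ^ j) ^ 2 := by
      rw [show (j + 1) ^ 2 = j ^ 2 + 1 + j * (2 : ℕ) by push_cast; ring, zpow_add₀ hq,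
        zpow_add₀ hq, zpow_mul, zpow_natCast, zpow_one]
    have xj : x ^ j = (q ^ j) ^ 2 := by
      rw [hqx, ← zpow_natCast, ← zpow_natCast, ← zpow_mul, ← zpow_mul, mul_comm]
    have s1 : (-1 : ℂ) ^ (j - 1) = -(-1) ^ j := by
      rw [zpow_sub₀ (by norm_num), zpow_one, div_neg, div_one]
    have s2 : (-1 : ℂ) ^ (j + 1) = -(-1) ^ j := by
      rw [zpow_add₀ (by norm_num)]; norm_num
    have hz : q ^ j ≠ 0 := zpow_ne_zero _ hq
    simp only [Function.comp_apply, Equiv.subRight_apply, Equiv.coe_addRight, Nat.cast_add,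
      Nat.cast_one, e5, e6, e3, e4, e1, e2, q1, q2, s1, s2]
    rw [show 2 * (n + 1) = 2 * n + 1 + 1 by ring, pochN_succ, pochN_succ]
    simp only [zpow_add₀ hx0, zpow_sub₀ hx0, zpow_natCast, zpow_one, xj]
    generalize pochRecip x (n + 1 - j) = a
    generalize pochRecip x (n + 1 + j) = b
    generalize q ^ (j ^ 2) = c
    generalize q ^ j = z at hz ⊢
    subst hqx
    field_simp
    ring

/-- The even-index part of `hasSum_finite_jacobi`. -/
lemma hasSum_finite_jacobi_even {q x : ℂ} (hq : q ≠ 0) (hx : ‖x‖ < 1) (hqx : x = q ^ 2) (n : ℕ) :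
    HasSum (fun k : ℤ => x ^ (2 * k.natAbs ^ 2) *
      (pochN x x (2 * n) * pochRecip x (n - 2 * k) * pochRecip x (n + 2 * k)))
      ((pochN q x n ^ 2 + pochN (-q) x n ^ 2) / 2) := by
  have h := ((hasSum_finite_jacobi hq hx hqx n).add (hasSum_finite_jacobi (neg_ne_zero.mpr hq) hx
    (by rw [hqx]; ring) n)).div_const 2
  have hinj : Function.Injective fun k : ℤ => 2 * k := fun a b hab => by simpa using hab
  rw [← hinj.hasSum_iff] at h
  · refine h.congr_fun fun k => ?_
    have hp : q ^ ((2 * k) ^ 2) = x ^ (2 * k.natAbs ^ 2) := by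
      rw [hqx, ← pow_mul, ← zpow_natCast]
      congr 1
      push_cast
      rw [sq_abs]
      ring
    have hn : (-q) ^ ((2 * k) ^ 2) = q ^ ((2 * k) ^ 2) :=
      Even.neg_zpow ⟨2 * k ^ 2, by ring⟩ q
    have hs : (-1 : ℂ) ^ (2 * k) = 1 := Even.neg_one_zpow ⟨k, by ring⟩
    simp only [Function.comp_apply, hn, hp, hs]
    ring
  · intro j hj
    have hodd : Odd j := by
      rw [← Int.not_even_iff_odd]
      rintro ⟨k, rfl⟩
      exact hj ⟨k, by ring⟩
    rw [(hodd.pow (n := 2)).neg_zpow]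
    ring

/-- The summand of the conjugate Bailey pair. -/
noncomputable def conjBaileyTerm (x : ℂ) (n : ℕ) (j : ℤ) : ℂ :=
  x ^ n * (pochN x (x ^ 2) n * pochN x x n) * pochRecip x (n - j) * pochRecip x (n + j)

lemma exists_norm_conjBaileyTerm_le {x : ℂ} (hx : ‖x‖ < 1) :
    ∃ C, 0 ≤ C ∧ ∀ n j, ‖conjBaileyTerm x n j‖ ≤ C * ‖x‖ ^ n := by
  obtain ⟨A, hA0, hA⟩ := exists_norm_le_of_tendsto (tendsto_pochN x (norm_sq_lt_one hx))
  obtain ⟨B, hB0, hB⟩ := exists_norm_le_of_tendsto (tendsto_pochN x hx)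
  obtain ⟨D, hD0, hD⟩ := exists_norm_pochRecip_le hx
  refine ⟨A * B * D * D, by positivity, fun n j => ?_⟩
  rw [conjBaileyTerm, norm_mul, norm_mul, norm_mul, norm_mul, norm_pow]
  calc ‖x‖ ^ n * (‖pochN x (x ^ 2) n‖ * ‖pochN x x n‖) * ‖pochRecip x (n - j)‖ *
        ‖pochRecip x (n + j)‖ ≤ ‖x‖ ^ n * (A * B) * D * D := by
        gcongr
        exacts [hA n, hB n, hD _, hD _]
    _ = A * B * D * D * ‖x‖ ^ n := by ring

lemma summable_conjBaileyTerm {x : ℂ} (hx : ‖x‖ < 1) (j : ℤ) :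
    Summable fun n => conjBaileyTerm x n j := by
  obtain ⟨C, -, hC⟩ := exists_norm_conjBaileyTerm_le hx
  exact .of_norm_bounded ((summable_geometric_of_lt_one (norm_nonneg _) hx).mul_left C)
    fun n => hC n j

lemma sum_conjBaileyTerm {x : ℂ} (hx0 : x ≠ 0) (hx : ‖x‖ < 1) (j N : ℕ) :
    ∑ n ∈ Finset.range N,
      (conjBaileyTerm x n j + x ^ (3 * j + 3) * conjBaileyTerm x n (j + 2)) =
    x ^ j * (1 + x ^ (j + 1)) * (pochN x (x ^ 2) N * pochN x x N *
      pochRecip x (N + (-1 - j)) * pochRecip x (N + (j + 1))) := by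
  induction N with
  | zero => rw [pochRecip_of_neg x (m := ((0 : ℕ) : ℤ) + (-1 - j)) (by omega)]; simp
  | succ N ih =>
    rw [Finset.sum_range_succ, ih]
    have e1 : pochRecip x (N + (-1 - j)) = (1 - x ^ ((N : ℤ) - j)) * pochRecip x (N - j) := by
      rw [← pochRecip_sub_one hx]; congr 1; ring
    have e2 : pochRecip x (N - (j + 2)) =
        (1 - x ^ ((N : ℤ) - j - 1)) * ((1 - x ^ ((N : ℤ) - j)) * pochRecip x (N - j)) := by
      rw [← pochRecip_sub_one hx, ← pochRecip_sub_one hx]; congr 1; ring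
    have e3 : pochRecip x (N + (j + 1)) =
        (1 - x ^ ((N : ℤ) + j + 2)) * pochRecip x (N + j + 2) := by
      rw [← pochRecip_sub_one hx]; congr 1; ring
    have e4 : pochRecip x (N + j) =
        (1 - x ^ ((N : ℤ) + j + 1)) * ((1 - x ^ ((N : ℤ) + j + 2)) * pochRecip x (N + j + 2)) := by
      rw [← e3, show (N : ℤ) + (j + 1) = N + j + 1 by ring, ← pochRecip_sub_one hx]
      congr 1; ring
    have e5 : ((N + 1 : ℕ) : ℤ) + (-1 - j) = N - j := by push_cast; ring
    have e6 : ((N + 1 : ℕ) : ℤ) + (j + 1) = N + j + 2 := by push_cast; ring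
    have e7 : (N : ℤ) + (j + 2) = N + j + 2 := by ring
    rw [conjBaileyTerm, conjBaileyTerm, e5, e6, e7, e4, e2, e1, e3, pochN_succ, pochN_succ]
    have h2 : x ^ (2 : ℤ) = x ^ 2 := by norm_cast
    simp only [zpow_add₀ hx0, zpow_sub₀ hx0, zpow_natCast, zpow_one, h2]
    generalize pochRecip x (N - j) = a
    generalize pochRecip x (N + j + 2) = b
    field_simp
    ring

/-- The value of the sums `∑ n, conjBaileyTerm x n j` satisfies a two-step recurrence in `j`. -/
lemma tsum_conjBaileyTerm_recurrence {x : ℂ} (hx0 : x ≠ 0) (hx : ‖x‖ < 1) (j : ℕ) :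
    pochInf (x ^ 2) (x ^ 2) * ∑' n, conjBaileyTerm x n j =
      x ^ j * (1 + x ^ (j + 1)) - x ^ (3 * j + 3) *
        (pochInf (x ^ 2) (x ^ 2) * ∑' n, conjBaileyTerm x n (j + 2)) := by
  have hx2 := norm_sq_lt_one hx
  have hsum := ((summable_conjBaileyTerm hx j).hasSum.add
    ((summable_conjBaileyTerm hx (j + 2)).hasSum.mul_left (x ^ (3 * j + 3)))).tendsto_sum_nat
  simp only [sum_conjBaileyTerm hx0 hx] at hsum
  have hlim := ((((tendsto_pochN x hx2).mul (tendsto_pochN x hx)).mul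
    (tendsto_pochRecip hx (-1 - j))).mul (tendsto_pochRecip hx (j + 1))).const_mul
    (x ^ j * (1 + x ^ (j + 1)))
  have heq := tendsto_nhds_unique hsum hlim
  have hprod : pochInf x x =
      pochInf x x * pochInf (-x) x * pochInf x (x ^ 2) := by
    have h1 := (tendsto_pochN x hx).comp (tendsto_id.const_mul_atTop' (zero_lt_two (α := ℕ)))
    refine tendsto_nhds_unique h1 ?_
    refine (((tendsto_pochN x hx).mul (tendsto_pochN (-x) hx)).mul
      (tendsto_pochN x hx2)).congr fun n => ?_
    simp only [Function.comp_apply, id, pochN_two_mul]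
    ring
  have hneg : pochInf x x * pochInf (-x) x = pochInf (x ^ 2) (x ^ 2) :=
    tendsto_nhds_unique (((tendsto_pochN x hx).mul (tendsto_pochN (-x) hx)).congr
      fun n => pochN_mul_pochN_neg x n) (tendsto_pochN _ hx2)
  rw [hneg] at hprod
  have hne := pochInf_ne_zero hx hx
  rw [eq_sub_iff_add_eq]
  calc _ = pochInf (x ^ 2) (x ^ 2) * (∑' n, conjBaileyTerm x n j +
        x ^ (3 * j + 3) * ∑' n, conjBaileyTerm x n (j + 2)) := by ring
    _ = x ^ j * (1 + x ^ (j + 1)) * ((pochInf (x ^ 2) (x ^ 2) * pochInf x (x ^ 2)) *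
        (pochInf x x * (pochInf x x)⁻¹) * (pochInf x x)⁻¹) := by rw [heq]; ring
    _ = x ^ j * (1 + x ^ (j + 1)) := by
      rw [← hprod, mul_inv_cancel₀ hne, mul_one, mul_inv_cancel₀ hne, mul_one]

/-- The `n`-th coefficient of the Hecke-type double sum. -/
noncomputable def heckeCoeff (x : ℂ) (n : ℕ) : ℂ :=
  (-1) ^ n * x ^ (3 * n ^ 2 + 2 * n) * (1 + x ^ (2 * n + 1))

lemma norm_heckeCoeff_le {x : ℂ} (hx : ‖x‖ < 1) (n : ℕ) :
    ‖heckeCoeff x n‖ ≤ 2 * ‖x‖ ^ (3 * n ^ 2) := by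
  have h1 : ‖1 + x ^ (2 * n + 1)‖ ≤ 2 := by
    refine (norm_add_le _ _).trans ?_
    rw [norm_one, norm_pow]
    linarith [pow_le_one₀ (n := 2 * n + 1) (norm_nonneg x) hx.le]
  have h2 : ‖x‖ ^ (3 * n ^ 2 + 2 * n) ≤ ‖x‖ ^ (3 * n ^ 2) :=
    pow_le_pow_of_le_one (norm_nonneg _) hx.le (by omega)
  rw [heckeCoeff, norm_mul, norm_mul, norm_pow, norm_neg, norm_one, one_pow, one_mul, norm_pow,
    mul_comm]
  gcongr

lemma summable_pow_sq {r : ℝ} (h0 : 0 ≤ r) (h1 : r < 1) : Summable fun n : ℕ => r ^ (n ^ 2) :=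
  (summable_geometric_of_lt_one h0 h1).of_nonneg_of_le (fun _ => by positivity)
    fun n => pow_le_pow_of_le_one h0 h1.le (Nat.le_self_pow two_ne_zero n)

lemma summable_pow_natAbs_sq {r : ℝ} (h0 : 0 ≤ r) (h1 : r < 1) :
    Summable fun k : ℤ => r ^ (k.natAbs ^ 2) :=
  .of_nat_of_neg (by simpa using summable_pow_sq h0 h1) (by simpa using summable_pow_sq h0 h1)

lemma summable_heckeCoeff {x : ℂ} (hx : ‖x‖ < 1) : Summable (heckeCoeff x) :=
  .of_norm_bounded ((summable_pow_sq (norm_nonneg x) hx).mul_left 2) fun n =>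
    (norm_heckeCoeff_le hx n).trans (by
      gcongr 2 * ?_
      exact pow_le_pow_of_le_one (norm_nonneg _) hx.le (by omega))

lemma conjBaileyTerm_neg (x : ℂ) (n : ℕ) (j : ℤ) :
    conjBaileyTerm x n (-j) = conjBaileyTerm x n j := by
  rw [conjBaileyTerm, conjBaileyTerm, sub_neg_eq_add, ← sub_eq_add_neg]
  ring

/-- The sums `∑ n, conjBaileyTerm x n (2 k)` are tails of the series of `heckeCoeff x`. -/
lemma tsum_heckeCoeff_tail {x : ℂ} (hx0 : x ≠ 0) (hx : ‖x‖ < 1) (k : ℕ) :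
    ∑' n, heckeCoeff x (n + k) = (-1) ^ k * x ^ (3 * k ^ 2) *
      (pochInf (x ^ 2) (x ^ 2) * ∑' n, conjBaileyTerm x n ((2 * k : ℕ) : ℤ)) := by
  set H : ℕ → ℂ := fun k => (-1) ^ k * x ^ (3 * k ^ 2) *
      (pochInf (x ^ 2) (x ^ 2) * ∑' n, conjBaileyTerm x n ((2 * k : ℕ) : ℤ)) with hH
  have hstep : ∀ m, heckeCoeff x m = H m - H (m + 1) := by
    intro m
    simp only [hH]
    rw [tsum_conjBaileyTerm_recurrence hx0 hx (2 * m), heckeCoeff,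
      show ((2 * (m + 1) : ℕ) : ℤ) = ((2 * m : ℕ) : ℤ) + 2 by push_cast; ring]
    ring
  have hlim : Tendsto H atTop (𝓝 0) := by
    obtain ⟨C, hC0, hC⟩ := exists_norm_conjBaileyTerm_le hx
    have hgeo := (hasSum_geometric_of_lt_one (norm_nonneg _) hx).mul_left C
    refine squeeze_zero_norm (a := fun k => ‖x‖ ^ k *
      (‖pochInf (x ^ 2) (x ^ 2)‖ * (C * (1 - ‖x‖)⁻¹))) (fun k => ?_) ?_
    · simp only [hH, norm_mul, norm_pow, norm_neg, norm_one, one_pow, one_mul]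
      gcongr ?_ * (_ * ?_)
      · exact pow_le_pow_of_le_one (norm_nonneg _) hx.le (by nlinarith)
      · exact tsum_of_norm_bounded hgeo fun n => hC n _
    · simpa using (tendsto_pow_atTop_nhds_zero_of_lt_one (norm_nonneg _) hx).mul_const
        (‖pochInf (x ^ 2) (x ^ 2)‖ * (C * (1 - ‖x‖)⁻¹))
  have hs := ((summable_nat_add_iff k).mpr (summable_heckeCoeff hx)).hasSum.tendsto_sum_nat
  have hpart : ∀ N, ∑ n ∈ Finset.range N, heckeCoeff x (n + k) = H k - H (N + k) := by
    intro N
    induction N with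
    | zero => simp
    | succ N ih => rw [Finset.sum_range_succ, ih, hstep, Nat.add_right_comm N 1 k]; ring
  simp only [hpart] at hs
  have h2 := (tendsto_const_nhds (x := H k)).sub ((tendsto_add_atTop_iff_nat k).mpr hlim)
  rw [sub_zero] at h2
  exact tendsto_nhds_unique hs h2

/-- Interchange of the two summations in the Hecke-type double sum. -/
lemma tsum_heckeCoeff_mul_sum {x : ℂ} (hx0 : x ≠ 0) (hx : ‖x‖ < 1) :
    ∑' n : ℕ, heckeCoeff x n * ∑ k ∈ Finset.Icc (-(n : ℤ)) n, (-1) ^ k * x ^ (-k ^ 2) =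
      ∑' k : ℤ, (-1) ^ k * x ^ (-k ^ 2) * ∑' n, heckeCoeff x (n + k.natAbs) := by
  set f : ℕ → ℤ → ℂ := fun n k =>
    if k.natAbs ≤ n then heckeCoeff x n * ((-1) ^ k * x ^ (-k ^ 2)) else 0 with hf
  have hsum : Summable (Function.uncurry f) := by
    refine .of_norm_bounded (g := fun p : ℕ × ℤ => 2 * (‖x‖ ^ (p.1 ^ 2) * ‖x‖ ^ (p.2.natAbs ^ 2)))
      (((summable_pow_sq (norm_nonneg x) hx).mul_of_nonneg
        (summable_pow_natAbs_sq (norm_nonneg x) hx) (fun _ => by positivity)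
        (fun _ => by positivity)).mul_left 2) ?_
    rintro ⟨n, k⟩
    simp only [Function.uncurry_apply_pair, hf]
    split_ifs with h
    · have hk : ((k.natAbs ^ 2 : ℕ) : ℤ) = k ^ 2 := by push_cast; exact sq_abs k
      have hle : k.natAbs ^ 2 ≤ n ^ 2 := Nat.pow_le_pow_left h 2
      have hxn : ‖x‖ ≠ 0 := norm_ne_zero_iff.mpr hx0
      rw [norm_mul, norm_mul, norm_zpow, norm_zpow, norm_neg, norm_one, one_zpow, one_mul, ← hk,
        zpow_neg, zpow_natCast]
      refine (mul_le_mul_of_nonneg_right (norm_heckeCoeff_le hx n) (by positivity)).trans ?_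
      rw [← div_eq_mul_inv, div_le_iff₀ (by positivity), mul_assoc 2, ← pow_add, ← pow_add]
      gcongr 2 * ?_
      exact pow_le_pow_of_le_one (norm_nonneg _) hx.le (by omega)
    · rw [norm_zero]; positivity
  calc _ = ∑' n, ∑' k, f n k := by
        refine tsum_congr fun n => ?_
        rw [tsum_eq_sum (s := Finset.Icc (-(n : ℤ)) n), Finset.mul_sum]
        · refine Finset.sum_congr rfl fun k hk => ?_
          rw [Finset.mem_Icc] at hk
          rw [hf]
          simp only
          rw [if_pos (by omega)]
        · intro k hk
          rw [Finset.mem_Icc] at hk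
          simp only [hf]
          rw [if_neg (by omega)]
    _ = ∑' k, ∑' n, f n k := hsum.tsum_comm.symm
    _ = _ := by
        refine tsum_congr fun k => ?_
        rw [← tsum_mul_left]
        have hinj : Function.Injective fun n : ℕ => n + k.natAbs := add_left_injective _
        rw [← hinj.tsum_eq (f := fun n => f n k)]
        · refine tsum_congr fun n => ?_
          simp only [hf]
          rw [if_pos (by omega), mul_comm]
        · intro n hn
          have : k.natAbs ≤ n := by
            by_contra hlt
            exact hn (if_neg hlt)
          exact ⟨n - k.natAbs, by simp only; omega⟩

lemma summable_Sq_term {a x : ℂ} (hx : ‖x‖ < 1) :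
    Summable fun n : ℕ => pochN a x n ^ 2 * x ^ n / pochN (-x) x n := by
  have hneg : ‖-x‖ < 1 := by rwa [norm_neg]
  obtain ⟨C, hC0, hC⟩ := exists_norm_le_of_tendsto (((tendsto_pochN a hx).pow 2).div
    (tendsto_pochN (-x) hx) (pochInf_ne_zero hneg hx))
  refine .of_norm_bounded ((summable_geometric_of_lt_one (norm_nonneg _) hx).mul_left C) fun n => ?_
  rw [mul_div_right_comm, norm_mul, norm_pow]
  gcongr
  exact hC n

/-- The even part of `S`, as a series of the sums over the conjugate Bailey pair. -/
lemma Sq_add_Sq_neg_div_two {q x : ℂ} (hq : q ≠ 0) (hx : ‖x‖ < 1) (hqx : x = q ^ 2) :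
    (Sq q + Sq (-q)) / 2 =
      ∑' k : ℤ, x ^ (2 * k.natAbs ^ 2) * ∑' n, conjBaileyTerm x n (2 * k) := by
  have hneg : ‖-x‖ < 1 := by rwa [norm_neg]
  have h1 : Sq q = ∑' n : ℕ, pochN q x n ^ 2 * x ^ n / pochN (-x) x n := by
    rw [Sq, hqx]; simp only [pow_mul]
  have h2 : Sq (-q) = ∑' n : ℕ, pochN (-q) x n ^ 2 * x ^ n / pochN (-x) x n := by
    rw [Sq, hqx]; simp only [pow_mul, neg_sq]
  have hsum : Summable (Function.uncurry fun (n : ℕ) (k : ℤ) =>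
      x ^ (2 * k.natAbs ^ 2) * conjBaileyTerm x n (2 * k)) := by
    obtain ⟨C, hC0, hC⟩ := exists_norm_conjBaileyTerm_le hx
    have hg : Summable fun p : ℕ × ℤ => C * (‖x‖ ^ p.1 * ‖x‖ ^ (p.2.natAbs ^ 2)) :=
      ((summable_geometric_of_lt_one (norm_nonneg x) hx).mul_of_nonneg
        (summable_pow_natAbs_sq (norm_nonneg x) hx) (fun n => pow_nonneg (norm_nonneg x) n)
        (fun k => pow_nonneg (norm_nonneg x) _)).mul_left C
    refine .of_norm_bounded hg ?_
    rintro ⟨n, k⟩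
    rw [Function.uncurry_apply_pair, norm_mul, norm_pow, mul_comm, ← mul_assoc]
    refine mul_le_mul (hC n _) ?_ (by positivity) (by positivity)
    exact pow_le_pow_of_le_one (norm_nonneg _) hx.le (by simp only; omega)
  rw [h1, h2, ← (summable_Sq_term hx).tsum_add (summable_Sq_term hx), ← tsum_div_const]
  simp only [← tsum_mul_left]
  rw [hsum.tsum_comm]
  refine tsum_congr fun n => ?_
  have h := (hasSum_finite_jacobi_even hq hx hqx n).mul_left (x ^ n / pochN (-x) x n)
  rw [show (pochN q x n ^ 2 * x ^ n / pochN (-x) x n + pochN (-q) x n ^ 2 * x ^ n /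
    pochN (-x) x n) / 2 = x ^ n / pochN (-x) x n * ((pochN q x n ^ 2 + pochN (-q) x n ^ 2) / 2) by
    ring, ← h.tsum_eq]
  refine tsum_congr fun k => ?_
  have hne := pochN_ne_zero hneg hx n
  rw [conjBaileyTerm, pochN_two_mul]
  field_simp

lemma Sq_zero : Sq 0 = 1 := by
  rw [Sq, tsum_eq_single 0 fun n hn => by simp [hn]]
  simp [pochN_zero]

/-- Andrews–Bachraoui Conjecture 4: the even sieve `((q⁴;q⁴)_∞ S(q)) | S_{2,0}`,
written as the average `(F(q) + F(−q))/2`, equals the Hecke-type double sum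
`Σ_{n ≥ 0} (−1)ⁿ q^{6n²+4n}(1 + q^{4n+2}) Σ_{|j| ≤ n} (−1)ʲ q^{−2j²}`. -/
theorem stmt0 (q : ℂ) (hq : ‖q‖ < 1) :
    (pochInf (q ^ 4) (q ^ 4) * Sq q + pochInf ((-q) ^ 4) ((-q) ^ 4) * Sq (-q)) / 2 =
      ∑' n : ℕ, (-1 : ℂ) ^ n * q ^ (6 * n ^ 2 + 4 * n) * (1 + q ^ (4 * n + 2)) *
        ∑ j ∈ Finset.Icc (-(n : ℤ)) (n : ℤ), (-1 : ℂ) ^ j * q ^ (-2 * j ^ 2) := by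
  rcases eq_or_ne q 0 with rfl | hq0
  · rw [tsum_eq_single 0 fun n hn => by simp [hn]]
    simp [Sq_zero, pochInf]
  obtain ⟨x, hqx⟩ : ∃ x, x = q ^ 2 := ⟨_, rfl⟩
  have hx : ‖x‖ < 1 := hqx ▸ norm_sq_lt_one hq
  have hx0 : x ≠ 0 := hqx ▸ pow_ne_zero 2 hq0
  have h4 : q ^ 4 = x ^ 2 := by rw [hqx]; ring
  have hrhs : ∀ n : ℕ, (-1 : ℂ) ^ n * q ^ (6 * n ^ 2 + 4 * n) * (1 + q ^ (4 * n + 2)) *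
      ∑ j ∈ Finset.Icc (-(n : ℤ)) (n : ℤ), (-1 : ℂ) ^ j * q ^ (-2 * j ^ 2) =
      heckeCoeff x n * ∑ k ∈ Finset.Icc (-(n : ℤ)) n, (-1) ^ k * x ^ (-k ^ 2) := by
    intro n
    have hz : ∀ j : ℤ, q ^ (-2 * j ^ 2) = x ^ (-j ^ 2) := fun j => by
      rw [hqx, ← zpow_natCast, ← zpow_mul]
      congr 1
      push_cast
      ring
    simp only [hz]
    rw [heckeCoeff, hqx, ← pow_mul, ← pow_mul]
    ring_nf
  rw [tsum_congr hrhs, tsum_heckeCoeff_mul_sum hx0 hx, (by decide : Even 4).neg_pow, h4, ← mul_add,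
    mul_div_assoc, Sq_add_Sq_neg_div_two hq0 hx hqx, ← tsum_mul_left]
  refine tsum_congr fun k => ?_
  rw [tsum_heckeCoeff_tail hx0 hx]
  have hk : ∑' n, conjBaileyTerm x n (2 * k) =
      ∑' n, conjBaileyTerm x n ((2 * k.natAbs : ℕ) : ℤ) := by
    rcases Int.natAbs_eq k with h | h
    · rw [show ((2 * k.natAbs : ℕ) : ℤ) = 2 * k by omega]
    · rw [show ((2 * k.natAbs : ℕ) : ℤ) = -(2 * k) by omega]
      simp only [conjBaileyTerm_neg]
  have hs : (-1 : ℂ) ^ k * (-1) ^ k.natAbs = 1 := by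
    rw [← zpow_natCast, ← zpow_add₀ (by norm_num)]
    apply Even.neg_one_zpow
    rcases Int.natAbs_eq k with h | h
    · exact ⟨k, by omega⟩
    · exact ⟨0, by omega⟩
  have hp : x ^ (-k ^ 2) * x ^ (3 * k.natAbs ^ 2) = x ^ (2 * k.natAbs ^ 2) := by
    rw [← zpow_natCast, ← zpow_natCast, ← zpow_add₀ hx0]
    congr 1
    push_cast
    rw [sq_abs]
    ring
  rw [hk, ← hp]
  linear_combination -(x ^ (-k ^ 2) * x ^ (3 * k.natAbs ^ 2) * (pochInf (x ^ 2) (x ^ 2) *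
    ∑' n, conjBaileyTerm x n ((2 * k.natAbs : ℕ) : ℤ))) * hs
end

section
/- For τ in the upper half-plane with v = Im(τ) > 0, and any integer n with n + 1/3 ≠ 0, the period integral ∫_{−τ̄}^{i∞} e^{3πi(n+1/3)² w} / √(−i(w+τ)) dw equals i·Γ(1/2, 6π(n+1/3)² v) · q^{−(3/2)(n+1/3)²} / (√(3π) |n+1/3|), where q = e^{2πiτ} and Γ(a,v) is the upper incomplete gamma function. -/
open Complex

open scoped Real

/-- Upper incomplete gamma function `Γ(a, v) = ∫_v^∞ e^{−t} t^{a−1} dt`. -/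
noncomputable def incGamma (a v : ℝ) : ℝ := ∫ t in Set.Ioi v, Real.exp (-t) * t ^ (a - 1)

/-- Affine change of variables in the upper incomplete gamma function. -/
theorem integral_exp_mul_rpow_shift (a : ℝ) {c x : ℝ} (hc : 0 < c) (hx : 0 ≤ x) :
    ∫ t in Set.Ioi (0 : ℝ), Real.exp (-(c * (x + t))) * (x + t) ^ (a - 1) =
      c ^ (-a) * incGamma a (c * x) := by
  have shift : ∫ t in Set.Ioi (0 : ℝ), Real.exp (-(c * (x + t))) * (x + t) ^ (a - 1) =
      ∫ s in Set.Ioi x, Real.exp (-(c * s)) * s ^ (a - 1) := by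
    have h := (MeasureTheory.measurePreserving_add_left MeasureTheory.volume x).setIntegral_preimage_emb
      (measurableEmbedding_addLeft x) (fun s => Real.exp (-(c * s)) * s ^ (a - 1)) (Set.Ioi x)
    simpa using h
  have scale := MeasureTheory.integral_comp_mul_left_Ioi
    (fun s => Real.exp (-s) * s ^ (a - 1)) x hc
  have factor : ∫ s in Set.Ioi x, Real.exp (-(c * s)) * (c * s) ^ (a - 1) =
      c ^ (a - 1) * ∫ s in Set.Ioi x, Real.exp (-(c * s)) * s ^ (a - 1) := by
    rw [← MeasureTheory.integral_const_mul]
    refine MeasureTheory.setIntegral_congr_fun measurableSet_Ioi fun s hs => ?_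
    have hs' : 0 ≤ s := hx.trans (le_of_lt hs)
    simp only [Real.mul_rpow hc.le hs']
    ring
  rw [factor, smul_eq_mul] at scale
  rw [shift, incGamma]
  have hpow : c ^ (-a) * c ^ (a - 1) = c⁻¹ := by
    rw [← Real.rpow_add hc, ← Real.rpow_neg_one]
    congr 1
    ring
  refine mul_left_cancel₀ (Real.rpow_pos_of_pos hc (a - 1)).ne' ?_
  rw [scale, ← hpow]
  ring

/-- Period integral evaluation: for `τ` in the upper half-plane with `v = Im τ` and an
integer `n` with `n + 1/3 ≠ 0`, the integral `∫_{−τ̄}^{i∞} e^{3πi(n+1/3)²w}/√(−i(w+τ)) dw`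
(along the vertical path `w = −τ̄ + it`, `t ∈ (0,∞)`, so `dw = i dt`) equals
`i Γ(1/2, 6π(n+1/3)²v) q^{−(3/2)(n+1/3)²} / (√(3π) |n+1/3|)` with `q = e^{2πiτ}`. -/
theorem stmt19 (τ : ℂ) (hτ : 0 < τ.im) (n : ℤ) (hn : (n : ℝ) + 1 / 3 ≠ 0) :
    (I * ∫ t in Set.Ioi (0 : ℝ),
        Complex.exp (3 * π * I * ((n : ℂ) + 1 / 3) ^ 2 * (-(starRingEnd ℂ) τ + I * t)) /
          (-I * ((-(starRingEnd ℂ) τ + I * t) + τ)) ^ ((1 : ℂ) / 2)) =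
      I * (incGamma (1 / 2) (6 * π * ((n : ℝ) + 1 / 3) ^ 2 * τ.im) : ℂ) *
          Complex.exp (2 * π * I * τ * (-(3 / 2) * ((n : ℂ) + 1 / 3) ^ 2)) /
        (Real.sqrt (3 * π) * |(n : ℝ) + 1 / 3|) := by
  set m : ℝ := (n : ℝ) + 1 / 3 with hm
  have hmc : (n : ℂ) + 1 / 3 = (m : ℂ) := by rw [hm]; push_cast; rfl
  have hc : 0 < 3 * π * m ^ 2 := by positivity
  have hconj : (starRingEnd ℂ) τ = τ - 2 * τ.im * I := by
    apply Complex.ext <;> simp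
    ring
  have integrand : ∀ t ∈ Set.Ioi (0 : ℝ),
      Complex.exp (3 * π * I * ((n : ℂ) + 1 / 3) ^ 2 * (-(starRingEnd ℂ) τ + I * t)) /
          (-I * ((-(starRingEnd ℂ) τ + I * t) + τ)) ^ ((1 : ℂ) / 2) =
        Complex.exp (2 * π * I * τ * (-(3 / 2) * ((n : ℂ) + 1 / 3) ^ 2)) *
          ((Real.exp (-(3 * π * m ^ 2 * (2 * τ.im + t))) *
            (2 * τ.im + t) ^ ((1 / 2 : ℝ) - 1) : ℝ) : ℂ) := by
    intro t ht
    have hs : 0 < 2 * τ.im + t := by have := Set.mem_Ioi.mp ht; positivity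
    have hbase : -I * ((-(starRingEnd ℂ) τ + I * t) + τ) = ((2 * τ.im + t : ℝ) : ℂ) := by
      rw [hconj]
      push_cast
      linear_combination -(2 * (τ.im : ℂ) + t) * I_sq
    have hroot : ((2 * τ.im + t : ℝ) : ℂ) ^ ((1 : ℂ) / 2) =
        (((2 * τ.im + t) ^ (1 / 2 : ℝ) : ℝ) : ℂ) := by
      rw [Complex.ofReal_cpow hs.le]
      norm_num
    have hexponent : 3 * π * I * (m : ℂ) ^ 2 * (-(starRingEnd ℂ) τ + I * t) =
        2 * π * I * τ * (-(3 / 2) * (m : ℂ) ^ 2) +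
          ((-(3 * π * m ^ 2 * (2 * τ.im + t)) : ℝ) : ℂ) := by
      rw [hconj]
      push_cast
      linear_combination (3 * π * (m : ℂ) ^ 2 * (2 * τ.im + t)) * I_sq
    have hneg : (2 * τ.im + t) ^ ((1 / 2 : ℝ) - 1) = ((2 * τ.im + t) ^ (1 / 2 : ℝ))⁻¹ := by
      rw [← Real.rpow_neg hs.le]
      norm_num
    rw [hmc, hbase, hroot, hexponent, Complex.exp_add, hneg]
    push_cast
    rw [div_eq_mul_inv, mul_assoc]
  have hconst : (3 * π * m ^ 2) ^ (-(1 / 2) : ℝ) = (Real.sqrt (3 * π) * |m|)⁻¹ := by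
    rw [Real.rpow_neg hc.le, ← Real.sqrt_eq_rpow, Real.sqrt_mul (by positivity),
      Real.sqrt_sq_eq_abs]
  rw [MeasureTheory.setIntegral_congr_fun measurableSet_Ioi integrand,
    MeasureTheory.integral_const_mul, integral_complex_ofReal,
    integral_exp_mul_rpow_shift (1 / 2) hc (by positivity), hconst,
    show 3 * π * m ^ 2 * (2 * τ.im) = 6 * π * m ^ 2 * τ.im by ring]
  push_cast
  rw [div_eq_mul_inv]
  ring
end
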